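/- Let 0 < p < 1 and let f be the martingale constructed from (α_k). Let k ≥ 1, let j ∈ N_{n_0} satisfy M_{α_k} ≤ j < M_{α_k+1}, and let x ∈ G_m \ I_1. Then |S_j f(x)| = (1/M) · M_{α_k}^{1/p−1} · Φ_{M_{α_k}}^{−1/4}. -/

import Mathlib

open MeasureTheory Filter Finset
open scoped Classical ENNReal NNReal

noncomputable section

namespace VilenkinPaper

/-- The generalized powers `M_0 = 1`, `M_{k+1} = m_k M_k`. -/
def Mseq (m : ℕ → ℕ) : ℕ → ℕ
  | 0 => 1
  | k + 1 => m k * Mseq m k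

/-- The Vilenkin group `G_m = ∏_k ℤ_{m_k}`. -/
abbrev Gm (m : ℕ → ℕ) : Type := (k : ℕ) → ZMod (m k)

/-- The `j`-th digit of `n` in the generalized number system based on `m`. -/
def digit (m : ℕ → ℕ) (n j : ℕ) : ℕ := n / Mseq m j % m j

/-- The generalized Rademacher functions `r_k(x) = exp(2πi x_k / m_k)`. -/
def rad (m : ℕ → ℕ) (k : ℕ) (x : Gm m) : ℂ :=
  Complex.exp (2 * Real.pi * Complex.I * ((x k).val : ℂ) / (m k : ℂ))

/-- The Vilenkin system `ψ_n = ∏_k r_k^{n_k}`. -/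
def psi (m : ℕ → ℕ) (n : ℕ) (x : Gm m) : ℂ := ∏ᶠ k : ℕ, rad m k x ^ digit m n k

/-- The Dirichlet kernels `D_n = ∑_{k<n} ψ_k`. -/
def Dker (m : ℕ → ℕ) (n : ℕ) (x : Gm m) : ℂ := ∑ k ∈ Finset.range n, psi m k x

/-- The interval `I_n(x)` : all `y` agreeing with `x` on the first `n` coordinates. -/
def Iset (m : ℕ → ℕ) (n : ℕ) (x : Gm m) : Set (Gm m) := {y | ∀ k < n, y k = x k}

/-- `I_n := I_n(0)`. -/
def IsetO (m : ℕ → ℕ) (n : ℕ) : Set (Gm m) := Iset m n 0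

/-- `μ` is the normalized Haar (product) measure iff every interval `I_n(x)` has
measure `1 / M_n`. -/
def IsHaarGm (m : ℕ → ℕ) (μ : Measure (Gm m)) : Prop :=
  ∀ n x, μ (Iset m n x) = ((Mseq m n : ℝ≥0∞))⁻¹

/-- The σ-algebra `F_n` generated by the intervals `{I_n(x)}`, i.e. by the first `n`
coordinates. -/
def filt (m : ℕ → ℕ) (n : ℕ) : MeasurableSpace (Gm m) :=
  MeasurableSpace.comap (fun x (k : Fin n) => x k) ⊤

/-- A (Vilenkin) martingale with respect to the filtration `F_n`. -/
def IsVMartingale (m : ℕ → ℕ) (μ : Measure (Gm m)) (f : ℕ → Gm m → ℂ) : Prop :=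
  (∀ n, Integrable (f n) μ) ∧
  (∀ n, Measurable[filt m n] (f n)) ∧
  (∀ n N, n ≤ N → μ[f N | filt m n] =ᵐ[μ] f n)

/-- Membership in the martingale Hardy space `H_p`: the maximal function
`f* = sup_n |f^{(n)}|` belongs to `L_p`. -/
def MemHp (m : ℕ → ℕ) (μ : Measure (Gm m)) (p : ℝ) (f : ℕ → Gm m → ℂ) : Prop :=
  ∫⁻ x, (⨆ n, (‖f n x‖₊ : ℝ≥0∞)) ^ p ∂μ < ⊤

/-- The `i`-th Vilenkin–Fourier coefficient of an integrable function. -/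
def fourierCoefFn (m : ℕ → ℕ) (μ : Measure (Gm m)) (g : Gm m → ℂ) (i : ℕ) : ℂ :=
  ∫ x, g x * (starRingEnd ℂ) (psi m i x) ∂μ

/-- The partial sum `S_n` built from a sequence `c` of Fourier coefficients. -/
def Spart (m : ℕ → ℕ) (c : ℕ → ℂ) (n : ℕ) (x : Gm m) : ℂ :=
  ∑ k ∈ Finset.range n, c k * psi m k x

/-- The weak `L_{p,∞}` quasinorm `sup_{λ>0} λ μ(|g| > λ)^{1/p}`. -/
def wLp (m : ℕ → ℕ) (μ : Measure (Gm m)) (p : ℝ) (g : Gm m → ℂ) : ℝ≥0∞ :=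
  ⨆ (t : ℝ) (_ : 0 < t), ENNReal.ofReal t * μ {x | t < ‖g x‖} ^ (1 / p)

/-- `|n| = max {j : n_j ≠ 0}`. -/
def maxDigit (m : ℕ → ℕ) (n : ℕ) : ℕ := sSup {j | digit m n j ≠ 0}

/-- The set `ℕ_{n_0}` of positive integers with `n_0 = n_{|n|} = 1`. -/
def Nn0 (m : ℕ → ℕ) : Set ℕ :=
  {n | 0 < n ∧ digit m n 0 = 1 ∧ digit m n (maxDigit m n) = 1}

/-- The atom `a = (M_α^{1/p-1}/M) (D_{M_{α+1}} - D_{M_α})`. -/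
def atomFun (m : ℕ → ℕ) (MM : ℕ) (p : ℝ) (a : ℕ) (x : Gm m) : ℂ :=
  (((Mseq m a : ℝ) ^ (1 / p - 1) / (MM : ℝ) : ℝ) : ℂ) *
    (Dker m (Mseq m (a + 1)) x - Dker m (Mseq m a) x)

/-- The coefficients `λ_k = Φ_{M_{α_k}}^{-1/4}`. -/
def lamSeq (m : ℕ → ℕ) (Φ : ℕ → ℝ) (α : ℕ → ℕ) (k : ℕ) : ℝ :=
  Φ (Mseq m (α k)) ^ (-(1 / 4 : ℝ))

/-- The martingale `f^{(A)} = ∑_{k : α_k < A} λ_k a_k` of the counterexample construction. -/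
def fCon (m : ℕ → ℕ) (MM : ℕ) (p : ℝ) (Φ : ℕ → ℝ) (α : ℕ → ℕ) (A : ℕ) (x : Gm m) : ℂ :=
  ∑ᶠ (k : ℕ) (_ : α k < A), (lamSeq m Φ α k : ℂ) * atomFun m MM p (α k) x

theorem lt_Mseq {m : ℕ → ℕ} (hm : ∀ k, 2 ≤ m k) (k : ℕ) : k < Mseq m k := by
  induction k with
  | zero => simp [Mseq]
  | succ k ih =>
    have := Nat.mul_le_mul_right (Mseq m k) (hm k)
    simp only [Mseq]
    omega

theorem Mseq_monotone {m : ℕ → ℕ} (hm : ∀ k, 2 ≤ m k) : Monotone (Mseq m) :=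
  monotone_nat_of_le_succ fun k => Nat.le_mul_of_pos_left _ (by have := hm k; omega)

theorem digit_eq_zero {m : ℕ → ℕ} (hm : ∀ k, 2 ≤ m k) {n k : ℕ} (h : n ≤ k) :
    digit m n k = 0 := by
  rw [digit, Nat.div_eq_of_lt (h.trans_lt (lt_Mseq hm k)), Nat.zero_mod]

theorem digit_lt {m : ℕ → ℕ} (hm : ∀ k, 2 ≤ m k) (n k : ℕ) : digit m n k < m k :=
  Nat.mod_lt _ (by have := hm k; omega)

theorem mod_Mseq_eq_of_digit_eq {m : ℕ → ℕ} {n i N : ℕ}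
    (h : ∀ k < N, digit m n k = digit m i k) : n % Mseq m N = i % Mseq m N := by
  induction N with
  | zero => simp [Mseq, Nat.mod_one]
  | succ N ih =>
    have hN := h N N.lt_succ_self
    simp only [digit] at hN
    rw [Mseq, mul_comm, Nat.mod_mul, Nat.mod_mul, ih fun k hk => h k (hk.trans N.lt_succ_self), hN]

theorem exists_digit_ne {m : ℕ → ℕ} (hm : ∀ k, 2 ≤ m k) {n i N : ℕ} (hn : n ≤ N) (hi : i ≤ N)
    (h : n ≠ i) : ∃ k < N, digit m n k ≠ digit m i k := by
  by_contra! hd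
  have := mod_Mseq_eq_of_digit_eq hd
  rw [Nat.mod_eq_of_lt (hn.trans_lt (lt_Mseq hm N)),
    Nat.mod_eq_of_lt (hi.trans_lt (lt_Mseq hm N))] at this
  exact h this

/-- The primitive `q`-th root of unity `exp(2πi / q)`. -/
def unitRoot (q : ℕ) : ℂ := Complex.exp (2 * Real.pi * Complex.I / q)

theorem isPrimitiveRoot_unitRoot {q : ℕ} (hq : 2 ≤ q) : IsPrimitiveRoot (unitRoot q) q :=
  Complex.isPrimitiveRoot_exp q (by omega)

theorem rad_eq (m : ℕ → ℕ) (k : ℕ) (x : Gm m) : rad m k x = unitRoot (m k) ^ (x k).val := by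
  rw [rad, unitRoot, ← Complex.exp_nat_mul]
  ring_nf

theorem norm_unitRoot {q : ℕ} (hq : 2 ≤ q) : ‖unitRoot q‖ = 1 :=
  (isPrimitiveRoot_unitRoot hq).norm'_eq_one (by omega)

theorem geom_sum_eq_zero {w : ℂ} {q : ℕ} (h1 : w ≠ 1) (hq : w ^ q = 1) :
    ∑ r ∈ range q, w ^ r = 0 := by
  rw [geom_sum_eq h1, hq, sub_self, zero_div]

theorem sum_zmod_val {q : ℕ} [NeZero q] (f : ℕ → ℂ) :
    ∑ z : ZMod q, f z.val = ∑ r ∈ range q, f r := by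
  cases q with
  | zero => exact absurd rfl (NeZero.ne 0)
  | succ q => exact Fin.sum_univ_eq_sum_range f (q + 1)

theorem sum_unitRoot_pow_mul_conj {q : ℕ} [NeZero q] (hq : 2 ≤ q) {a b : ℕ} (ha : a < q)
    (hb : b < q) (hab : a ≠ b) :
    ∑ z : ZMod q, (unitRoot q ^ z.val) ^ a * (starRingEnd ℂ) ((unitRoot q ^ z.val) ^ b) = 0 := by
  have hp := isPrimitiveRoot_unitRoot hq
  have hn := norm_unitRoot hq
  have hconj : (starRingEnd ℂ) (unitRoot q) = (unitRoot q)⁻¹ := by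
    rw [Complex.inv_eq_conj hn]
  have h0 : unitRoot q ≠ 0 := hp.ne_zero (by omega)
  rw [sum_zmod_val fun r => (unitRoot q ^ r) ^ a * (starRingEnd ℂ) ((unitRoot q ^ r) ^ b)]
  have hterm : ∀ r, (unitRoot q ^ r) ^ a * (starRingEnd ℂ) ((unitRoot q ^ r) ^ b)
      = (unitRoot q ^ a * (unitRoot q ^ b)⁻¹) ^ r := by
    intro r
    simp only [map_pow, hconj, mul_pow, ← pow_mul, inv_pow]
    rw [mul_comm r a, mul_comm r b]
  simp only [hterm]
  apply geom_sum_eq_zero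
  · intro h
    rw [← div_eq_mul_inv, div_eq_one_iff_eq (pow_ne_zero _ h0)] at h
    exact hab (hp.pow_inj ha hb h)
  · rw [mul_pow, inv_pow, ← pow_mul, ← pow_mul, mul_comm a, mul_comm b, pow_mul, pow_mul,
      hp.pow_eq_one]
    simp

theorem psi_eq_prod {m : ℕ → ℕ} (hm : ∀ k, 2 ≤ m k) {n N : ℕ} (h : n ≤ N) (x : Gm m) :
    psi m n x = ∏ k ∈ range N, rad m k x ^ digit m n k := by
  refine finprod_eq_prod_of_mulSupport_subset _ fun k hk => ?_
  by_contra hkN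
  simp only [coe_range, Set.mem_Iio, not_lt] at hkN
  exact hk (by simp [digit_eq_zero hm (h.trans hkN)])

theorem norm_rad {m : ℕ → ℕ} (hm : ∀ k, 2 ≤ m k) (k : ℕ) (x : Gm m) : ‖rad m k x‖ = 1 := by
  rw [rad_eq, norm_pow, norm_unitRoot (hm k), one_pow]

theorem norm_psi {m : ℕ → ℕ} (hm : ∀ k, 2 ≤ m k) (n : ℕ) (x : Gm m) : ‖psi m n x‖ = 1 := by
  simp [psi_eq_prod hm le_rfl, norm_prod, norm_rad hm]

theorem measurable_psi {m : ℕ → ℕ} (hm : ∀ k, 2 ≤ m k) (n : ℕ) : Measurable (psi m n) := by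
  have : psi m n = fun x => ∏ k ∈ range n, (unitRoot (m k) ^ (x k).val) ^ digit m n k := by
    ext x
    simp only [psi_eq_prod hm le_rfl, rad_eq]
  rw [this]
  refine Finset.measurable_prod _ fun k _ => ?_
  exact (measurable_from_top (f := fun z : ZMod (m k) =>
    (unitRoot (m k) ^ z.val) ^ digit m n k)).comp (measurable_pi_apply k)

theorem IsHaarGm.isProbabilityMeasure {m : ℕ → ℕ} {μ : Measure (Gm m)} (hμ : IsHaarGm m μ) :
    IsProbabilityMeasure μ :=
  ⟨by simpa [Iset, Mseq] using hμ 0 0⟩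

theorem integrable_psi_mul_conj {m : ℕ → ℕ} (hm : ∀ k, 2 ≤ m k) {μ : Measure (Gm m)}
    (hμ : IsHaarGm m μ) (n i : ℕ) :
    Integrable (fun x => psi m n x * (starRingEnd ℂ) (psi m i x)) μ := by
  have := hμ.isProbabilityMeasure
  refine Integrable.of_bound (C := 1) ?_ (ae_of_all _ fun x => ?_)
  · exact ((measurable_psi hm n).mul
      (Complex.continuous_conj.measurable.comp (measurable_psi hm i))).aestronglyMeasurable
  · simp [norm_psi hm]

theorem map_restrict_singleton {m : ℕ → ℕ} {μ : Measure (Gm m)} (hμ : IsHaarGm m μ) (N : ℕ)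
    (y : (k : Fin N) → ZMod (m k)) :
    μ.map (fun (x : Gm m) (k : Fin N) => x k) {y} = (Mseq m N : ℝ≥0∞)⁻¹ := by
  rw [Measure.map_apply (by fun_prop) (measurableSet_singleton y),
    ← hμ N fun k => if h : k < N then y ⟨k, h⟩ else 0]
  congr 1
  ext x
  simp only [Set.mem_preimage, Set.mem_singleton_iff, funext_iff, Iset, Set.mem_ofPred_eq]
  constructor
  · intro h k hk
    rw [dif_pos hk]
    exact h ⟨k, hk⟩
  · intro h k
    rw [h k k.2, dif_pos k.2]

theorem integral_prod_coord {m : ℕ → ℕ} [∀ k, NeZero (m k)] {μ : Measure (Gm m)}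
    (hμ : IsHaarGm m μ) (N : ℕ) (g : (k : ℕ) → ZMod (m k) → ℂ) :
    ∫ x, ∏ k ∈ range N, g k (x k) ∂μ =
      (Mseq m N : ℝ)⁻¹ • ∏ k ∈ range N, ∑ z : ZMod (m k), g k z := by
  have := hμ.isProbabilityMeasure
  have hmeas : Measurable fun (x : Gm m) (k : Fin N) => x k := by fun_prop
  have := Measure.isProbabilityMeasure_map (μ := μ) hmeas.aemeasurable
  calc
    ∫ x, ∏ k ∈ range N, g k (x k) ∂μ = ∫ x : Gm m, ∏ k : Fin N, g k (x k) ∂μ := by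
      simp only [← Fin.prod_univ_eq_prod_range]
    _ = ∫ y : (k : Fin N) → ZMod (m k), ∏ k : Fin N, g k (y k)
          ∂(μ.map fun (x : Gm m) (k : Fin N) => x k) :=
      (integral_map hmeas.aemeasurable (measurable_of_finite
        fun y : (k : Fin N) → ZMod (m k) => ∏ k : Fin N, g k (y k)).aestronglyMeasurable).symm
    _ = ∑ y : (k : Fin N) → ZMod (m k), (Mseq m N : ℝ)⁻¹ • ∏ k : Fin N, g k (y k) := by
      rw [integral_fintype .of_finite]
      simp [measureReal_def, map_restrict_singleton hμ]
    _ = _ := by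
      rw [← smul_sum, ← Fin.prod_univ_eq_prod_range fun k => ∑ z : ZMod (m k), g k z,
        Fintype.prod_sum]

theorem integral_psi_mul_conj {m : ℕ → ℕ} (hm : ∀ k, 2 ≤ m k) {μ : Measure (Gm m)}
    (hμ : IsHaarGm m μ) (n i : ℕ) :
    ∫ x, psi m n x * (starRingEnd ℂ) (psi m i x) ∂μ = if n = i then 1 else 0 := by
  have := hμ.isProbabilityMeasure
  have (k : ℕ) : NeZero (m k) := ⟨by have := hm k; omega⟩
  split_ifs with h
  · subst h
    simp [Complex.mul_conj', norm_psi hm]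
  · obtain ⟨k, hk, hne⟩ := exists_digit_ne hm (le_max_left n i) (le_max_right n i) h
    simp only [psi_eq_prod hm (le_max_left n i), psi_eq_prod hm (le_max_right n i), map_prod,
      ← prod_mul_distrib, rad_eq]
    rw [integral_prod_coord hμ _ fun k z => (unitRoot (m k) ^ z.val) ^ digit m n k *
        (starRingEnd ℂ) ((unitRoot (m k) ^ z.val) ^ digit m i k),
      prod_eq_zero (mem_range.2 hk), smul_zero]
    exact sum_unitRoot_pow_mul_conj (hm k) (digit_lt hm n k) (digit_lt hm i k) hne

theorem integrable_Dker_mul_conj {m : ℕ → ℕ} (hm : ∀ k, 2 ≤ m k) {μ : Measure (Gm m)}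
    (hμ : IsHaarGm m μ) (J i : ℕ) :
    Integrable (fun x => Dker m J x * (starRingEnd ℂ) (psi m i x)) μ := by
  simp only [Dker, sum_mul]
  exact integrable_finsetSum _ fun n _ => integrable_psi_mul_conj hm hμ n i

theorem fourierCoefFn_Dker {m : ℕ → ℕ} (hm : ∀ k, 2 ≤ m k) {μ : Measure (Gm m)}
    (hμ : IsHaarGm m μ) (J i : ℕ) :
    fourierCoefFn m μ (Dker m J) i = if i < J then 1 else 0 := by
  simp only [fourierCoefFn, Dker, sum_mul]
  rw [integral_finsetSum _ fun n _ => integrable_psi_mul_conj hm hμ n i]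
  simp [integral_psi_mul_conj hm hμ]

/-- The coefficient of `D_{M_{α_l+1}} - D_{M_{α_l}}` in the counterexample martingale. -/
def blockCoef (m : ℕ → ℕ) (MM : ℕ) (p : ℝ) (Φ : ℕ → ℝ) (α : ℕ → ℕ) (l : ℕ) : ℂ :=
  (lamSeq m Φ α l : ℂ) * (((Mseq m (α l) : ℝ) ^ (1 / p - 1) / (MM : ℝ) : ℝ) : ℂ)

theorem fCon_eq_sum {m : ℕ → ℕ} {α : ℕ → ℕ} (hα : StrictMono α) (MM : ℕ) (p : ℝ) (Φ : ℕ → ℝ)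
    (A : ℕ) (x : Gm m) :
    fCon m MM p Φ α A x = ∑ l ∈ range A with α l < A, blockCoef m MM p Φ α l *
      (Dker m (Mseq m (α l + 1)) x - Dker m (Mseq m (α l)) x) := by
  have : {l | l ∈ range A ∧ α l < A} = {l | α l < A} := by
    ext l
    simpa using fun h => (hα.le_apply (x := l)).trans_lt h
  rw [fCon, ← finsum_mem_coe_finset, coe_filter, this]
  simp only [atomFun, blockCoef, mul_assoc, Set.mem_ofPred_eq]

theorem fourierCoefFn_fCon {m : ℕ → ℕ} (hm : ∀ k, 2 ≤ m k) {μ : Measure (Gm m)}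
    (hμ : IsHaarGm m μ) {α : ℕ → ℕ} (hα : StrictMono α) (MM : ℕ) (p : ℝ) (Φ : ℕ → ℝ)
    (A i : ℕ) :
    fourierCoefFn m μ (fCon m MM p Φ α A) i =
      ∑ l ∈ range A with α l < A, blockCoef m MM p Φ α l *
        ((if i < Mseq m (α l + 1) then 1 else 0) - if i < Mseq m (α l) then 1 else 0) := by
  simp only [fourierCoefFn, fCon_eq_sum hα, sum_mul, mul_assoc, sub_mul]
  rw [integral_finsetSum]
  swap
  · exact fun l _ => ((integrable_Dker_mul_conj hm hμ _ i).sub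
      (integrable_Dker_mul_conj hm hμ _ i)).const_mul _
  refine sum_congr rfl fun l _ => ?_
  rw [integral_const_mul, integral_sub (integrable_Dker_mul_conj hm hμ _ i)
    (integrable_Dker_mul_conj hm hμ _ i), ← fourierCoefFn_Dker hm hμ, ← fourierCoefFn_Dker hm hμ]
  rfl

theorem tendsto_fourierCoefFn_fCon {m : ℕ → ℕ} (hm : ∀ k, 2 ≤ m k) {μ : Measure (Gm m)}
    (hμ : IsHaarGm m μ) {α : ℕ → ℕ} (hα : StrictMono α) (MM : ℕ) (p : ℝ) (Φ : ℕ → ℝ)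
    {i K : ℕ} (hiK : i < K) :
    Tendsto (fun A => fourierCoefFn m μ (fCon m MM p Φ α A) i) atTop
      (nhds (∑ l ∈ range K, blockCoef m MM p Φ α l *
        ((if i < Mseq m (α l + 1) then 1 else 0) - if i < Mseq m (α l) then 1 else 0))) := by
  refine tendsto_const_nhds.congr' ?_
  filter_upwards [eventually_gt_atTop (α K)] with A hA
  rw [fourierCoefFn_fCon hm hμ hα]
  refine sum_subset (fun l hl => ?_) fun l _ hl => ?_
  · have h := (hα (mem_range.1 hl)).trans hA
    exact mem_filter.2 ⟨mem_range.2 (hα.le_apply.trans_lt h), h⟩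
  · have h : i < Mseq m (α l) := (hiK.trans_le ((not_lt.1 fun h => hl (mem_range.2 h)).trans
      hα.le_apply)).trans (lt_Mseq hm _)
    rw [if_pos h, if_pos (h.trans_le (Mseq_monotone hm (Nat.le_succ _))), sub_self, mul_zero]

theorem sum_indicator_mul_psi (m : ℕ → ℕ) (j J : ℕ) (x : Gm m) :
    ∑ i ∈ range j, (if i < J then 1 else 0) * psi m i x = Dker m (min j J) x := by
  simp only [ite_mul, one_mul, zero_mul, ← sum_filter, Dker]
  congr 1
  ext i
  simp

theorem rad_zero_ne_one {m : ℕ → ℕ} (hm : ∀ k, 2 ≤ m k) {x : Gm m} (hx : x ∉ IsetO m 1) :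
    rad m 0 x ≠ 1 := by
  have : NeZero (m 0) := ⟨by have := hm 0; omega⟩
  have hx0 : x 0 ≠ 0 := fun h => hx fun k hk => by
    obtain rfl : k = 0 := by omega
    exact h
  rw [rad_eq]
  exact (isPrimitiveRoot_unitRoot (hm 0)).pow_ne_one_of_pos_of_lt
    (by simpa using hx0) (ZMod.val_lt _)

theorem dvd_Mseq (m : ℕ → ℕ) {a : ℕ} (ha : 0 < a) : m 0 ∣ Mseq m a := by
  induction a, ha using Nat.le_induction with
  | base => simp [Mseq]
  | succ k _ ih => exact ih.mul_left _

theorem digit_mul_add {m : ℕ → ℕ} (q : ℕ) {r k : ℕ} (hr : r < m 0) (hk : k ≠ 0) :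
    digit m (m 0 * q + r) k = digit m (m 0 * q) k := by
  obtain ⟨t, ht⟩ := dvd_Mseq m (Nat.pos_of_ne_zero hk)
  rw [digit, digit, ht, ← Nat.div_div_eq_div_mul, ← Nat.div_div_eq_div_mul,
    Nat.mul_add_div (by omega), Nat.div_eq_of_lt hr, Nat.mul_div_cancel_left _ (by omega), add_zero]

theorem psi_mul_add {m : ℕ → ℕ} (hm : ∀ k, 2 ≤ m k) (q : ℕ) {r : ℕ} (hr : r < m 0) (x : Gm m) :
    psi m (m 0 * q + r) x = psi m (m 0 * q) x * rad m 0 x ^ r := by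
  rw [psi_eq_prod hm (Nat.le_succ (m 0 * q + r)),
    psi_eq_prod hm (show m 0 * q ≤ (m 0 * q + r).succ by omega),
    prod_range_succ', prod_range_succ']
  simp only [digit_mul_add q hr (Nat.succ_ne_zero _)]
  simp [digit, Mseq, Nat.mod_eq_of_lt hr]

theorem Dker_mul_eq_zero {m : ℕ → ℕ} (hm : ∀ k, 2 ≤ m k) {x : Gm m} (hx : x ∉ IsetO m 1)
    (q : ℕ) : Dker m (m 0 * q) x = 0 := by
  induction q with
  | zero => simp [Dker]
  | succ q ih =>
    rw [Dker, Nat.mul_succ, sum_range_add, ← Dker, ih, zero_add,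
      sum_congr rfl fun r hr => psi_mul_add hm q (mem_range.1 hr) x, ← mul_sum,
      geom_sum_eq_zero (rad_zero_ne_one hm hx), mul_zero]
    rw [rad_eq, ← pow_mul, mul_comm, pow_mul, (isPrimitiveRoot_unitRoot (hm 0)).pow_eq_one,
      one_pow]

theorem Dker_Mseq_eq_zero {m : ℕ → ℕ} (hm : ∀ k, 2 ≤ m k) {x : Gm m} (hx : x ∉ IsetO m 1)
    {a : ℕ} (ha : 0 < a) : Dker m (Mseq m a) x = 0 := by
  obtain ⟨t, ht⟩ := dvd_Mseq m ha
  rw [ht, Dker_mul_eq_zero hm hx]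

theorem norm_Dker_eq_one {m : ℕ → ℕ} (hm : ∀ k, 2 ≤ m k) {x : Gm m} (hx : x ∉ IsetO m 1)
    {j : ℕ} (hj : digit m j 0 = 1) : ‖Dker m j x‖ = 1 := by
  have hj' : j % m 0 = 1 := by simpa [digit, Mseq] using hj
  rw [← Nat.div_add_mod j (m 0), hj', Dker, sum_range_succ, ← Dker, Dker_mul_eq_zero hm hx,
    zero_add, norm_psi hm]

theorem statement14 (m : ℕ → ℕ) (hm : ∀ k, 2 ≤ m k)
    (MM : ℕ) (hMM : IsLUB (Set.range m) MM)
    (μ : Measure (Gm m)) (hμ : IsHaarGm m μ)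
    (p : ℝ) (hp0 : 0 < p) (hp1 : p < 1)
    (Φ : ℕ → ℝ) (hΦpos : ∀ n, 0 < Φ n) (hΦmono : Monotone Φ)
    (hΦtop : Tendsto Φ atTop atTop)
    (α : ℕ → ℕ) (hα : StrictMono α) (hα2 : ∀ k, 2 ≤ α k)
    (hsum : Summable fun k => Φ (Mseq m (α k)) ^ (-(p / 4) : ℝ))
    (c : ℕ → ℂ)
    (hc : ∀ i, Tendsto (fun k => fourierCoefFn m μ (fCon m MM p Φ α k) i) atTop (nhds (c i)))
    (k j : ℕ) (hjN : j ∈ Nn0 m)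
    (hj1 : Mseq m (α k) ≤ j) (hj2 : j < Mseq m (α k + 1))
    (x : Gm m) (hx : x ∉ IsetO m 1) :
    ‖Spart m c j x‖ =
      1 / (MM : ℝ) * (Mseq m (α k) : ℝ) ^ (1 / p - 1) * Φ (Mseq m (α k)) ^ (-(1 / 4) : ℝ) := by
  have hcoef (i : ℕ) (hi : i ∈ range j) := tendsto_nhds_unique (hc i)
    (tendsto_fourierCoefFn_fCon hm hμ hα MM p Φ (mem_range.1 hi))
  have hkj : k < j := (hα.le_apply.trans_lt (lt_Mseq hm _)).trans_le hj1
  have hS : Spart m c j x = ∑ l ∈ range j, blockCoef m MM p Φ α l *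
      (Dker m (min j (Mseq m (α l + 1))) x - Dker m (min j (Mseq m (α l))) x) := by
    rw [Spart, sum_congr rfl fun i hi => by rw [hcoef i hi, sum_mul], sum_comm]
    refine sum_congr rfl fun l _ => ?_
    simp only [mul_assoc, ← mul_sum, sub_mul, sum_sub_distrib, sum_indicator_mul_psi]
  rw [hS, sum_eq_single_of_mem k (mem_range.2 hkj), min_eq_left hj2.le, min_eq_right hj1,
    Dker_Mseq_eq_zero hm hx (by have := hα2 k; omega), sub_zero, norm_mul,
    norm_Dker_eq_one hm hx hjN.2.1, mul_one, blockCoef, lamSeq, ← Complex.ofReal_mul,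
    Complex.norm_of_nonneg]
  · ring
  · have := (hΦpos (Mseq m (α k))).le
    positivity
  · intro l _ hl
    rcases hl.lt_or_gt with h | h
    · have h1 : Mseq m (α l + 1) ≤ j := (Mseq_monotone hm (hα h)).trans hj1
      rw [min_eq_right h1, min_eq_right ((Mseq_monotone hm (Nat.le_succ _)).trans h1),
        Dker_Mseq_eq_zero hm hx (Nat.succ_pos _),
        Dker_Mseq_eq_zero hm hx (by have := hα2 l; omega), sub_zero, mul_zero]
    · have h1 : j ≤ Mseq m (α l) := hj2.le.trans (Mseq_monotone hm (hα h))
      rw [min_eq_left h1, min_eq_left (h1.trans (Mseq_monotone hm (Nat.le_succ _))), sub_self,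
        mul_zero]

end VilenkinPaper
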